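/- Let G₁ and G₂ be finite abelian groups, G = G₁ × G₂, and 1 ≤ k ≤ |G|. Assume that (k₁, k₂) is the unique pair with k₁ k₂ ≤ k, 1 ≤ kᵢ ≤ |Gᵢ|, and θ(k, G) = θ(k₁, G₁) · θ(k₂, G₂). Then there exist equality cases for (k, G) if and only if k = k₁ k₂ and there exist equality cases for (k₁, G₁) and for (k₂, G₂). Moreover, every equality case for (k, G) is of the form f₁ ⊗ f₂, i.e. (x₁, x₂) ↦ f₁(x₁) f₂(x₂), where fᵢ is an equality case for (kᵢ, Gᵢ) for i = 1, 2. -/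

import Mathlib

open Function

/-- The Fourier transform of `f : G → ℂ` on a finite abelian group `G`, as a function on the
dual group of characters: `f̂(χ) = ∑ x, f x * χ(-x)`. -/
noncomputable def dft (G : Type*) [AddCommGroup G] [Fintype G] (f : G → ℂ) :
    AddChar G ℂ → ℂ :=
  fun χ => ∑ x : G, f x * χ (-x)

/-- Meshulam's function `θ(k, G)`: the minimal size of the spectrum of a nonzero function
on `G` whose support has size at most `k`. -/
noncomputable def theta (G : Type*) [AddCommGroup G] [Fintype G] (k : ℕ) : ℕ :=
  sInf {l | ∃ f : G → ℂ, f ≠ 0 ∧ (support f).ncard ≤ k ∧ (support (dft G f)).ncard = l}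

/-- An equality case for `(k, G)`: a nonzero function with support of size exactly `k`
and spectrum of minimal size `θ(k, G)`. -/
def IsEqualityCase (G : Type*) [AddCommGroup G] [Fintype G] (k : ℕ) (f : G → ℂ) : Prop :=
  f ≠ 0 ∧ (support f).ncard = k ∧ (support (dft G f)).ncard = theta G k

section Functions

variable {α β : Type*}

/-- If every fibre of `P` over `X` has at least `n` points, then `P` has at least `|X| n`. -/
theorem ncard_mul_le_ncard_of_fibers [Finite α] [Finite β] (P : Set (α × β))
    (X : Set α) (n : ℕ) (h : ∀ a ∈ X, n ≤ {b | (a, b) ∈ P}.ncard) :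
    X.ncard * n ≤ P.ncard := by
  classical
  have := Fintype.ofFinite α
  have := Fintype.ofFinite β
  rw [Set.ncard_eq_toFinset_card' X, Set.ncard_eq_toFinset_card' P, ← smul_eq_mul]
  calc X.toFinset.card • n ≤ ∑ a ∈ X.toFinset, {b | (a, b) ∈ P}.toFinset.card := by
        refine Finset.card_nsmul_le_sum _ _ _ fun a ha => ?_
        rw [← Set.ncard_eq_toFinset_card']
        exact h a (by simpa using ha)
    _ = (X.toFinset.sigma fun a => {b | (a, b) ∈ P}.toFinset).card := (Finset.card_sigma _ _).symm
    _ ≤ P.toFinset.card := by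
        refine Finset.card_le_card_of_injOn (fun p => (p.1, p.2)) ?_ ?_
        · intro p hp
          simp only [Finset.coe_sigma, Set.mem_sigma_iff, Finset.mem_coe, Set.mem_toFinset,
            Set.mem_ofPred_eq] at hp ⊢
          exact hp.2
        · rintro ⟨a, b⟩ _ ⟨c, d⟩ _ h
          simpa using h

theorem ncard_support_tensor (f₁ : α → ℂ) (f₂ : β → ℂ) :
    (support fun x : α × β => f₁ x.1 * f₂ x.2).ncard =
      (support f₁).ncard * (support f₂).ncard := by
  rw [← Set.ncard_prod]
  congr 1
  ext p
  simp

theorem tensor_ne_zero {f₁ : α → ℂ} {f₂ : β → ℂ} (h₁ : f₁ ≠ 0) (h₂ : f₂ ≠ 0) :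
    (fun x : α × β => f₁ x.1 * f₂ x.2) ≠ 0 := by
  obtain ⟨a, ha⟩ := Function.ne_iff.1 h₁
  obtain ⟨b, hb⟩ := Function.ne_iff.1 h₂
  exact Function.ne_iff.2 ⟨(a, b), mul_ne_zero ha hb⟩

theorem ncard_support_swap (f : α × β → ℂ) :
    (support fun x : β × α => f x.swap).ncard = (support f).ncard := by
  rw [← Set.ncard_image_of_injective _ Prod.swap_injective, Set.image_swap_eq_preimage_swap]
  rfl

theorem one_le_ncard_support [Finite α] {f : α → ℂ} (hf : f ≠ 0) :
    1 ≤ (support f).ncard :=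
  (Set.ncard_pos (Set.toFinite _)).2 (support_nonempty_iff.2 hf)

theorem ncard_support_le_card [Fintype α] (f : α → ℂ) :
    (support f).ncard ≤ Fintype.card α := by
  rw [← Nat.card_eq_fintype_card]
  exact Set.ncard_le_card _

/-- The first coordinates of the points of the support of `f`. -/
def rowSupport (f : α × β → ℂ) : Set α := {x₁ | (fun x₂ => f (x₁, x₂)) ≠ 0}

theorem rowSupport_nonempty {f : α × β → ℂ} (hf : f ≠ 0) : (rowSupport f).Nonempty := by
  obtain ⟨a, ha⟩ := Function.ne_iff.1 hf
  exact ⟨a.1, Function.ne_iff.2 ⟨a.2, ha⟩⟩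

theorem support_subset_prod (f : α × β → ℂ) :
    support f ⊆ rowSupport f ×ˢ rowSupport fun x : β × α => f x.swap :=
  fun x hx => ⟨Function.ne_iff.2 ⟨x.2, hx⟩, Function.ne_iff.2 ⟨x.1, hx⟩⟩

end Functions

section Dual

variable {G₁ G₂ : Type*} [AddCommGroup G₁] [AddCommGroup G₂]

/-- The dual of a product is the product of the duals. -/
def addCharProdEquiv (G₁ G₂ : Type*) [AddCommGroup G₁] [AddCommGroup G₂] :
    AddChar G₁ ℂ × AddChar G₂ ℂ ≃ AddChar (G₁ × G₂) ℂ where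
  toFun p := p.1.compAddMonoidHom (AddMonoidHom.fst G₁ G₂) *
    p.2.compAddMonoidHom (AddMonoidHom.snd G₁ G₂)
  invFun χ := (χ.compAddMonoidHom (AddMonoidHom.inl G₁ G₂),
    χ.compAddMonoidHom (AddMonoidHom.inr G₁ G₂))
  left_inv p := by
    ext x <;> simp
  right_inv χ := by
    ext x
    simp [← AddChar.map_add_eq_mul]

theorem addCharProdEquiv_apply (p : AddChar G₁ ℂ × AddChar G₂ ℂ) (x : G₁ × G₂) :
    addCharProdEquiv G₁ G₂ p x = p.1 x.1 * p.2 x.2 := rfl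

variable [Fintype G₁] [Fintype G₂]

theorem dft_addCharProdEquiv (f : G₁ × G₂ → ℂ) (p : AddChar G₁ ℂ × AddChar G₂ ℂ) :
    dft (G₁ × G₂) f (addCharProdEquiv G₁ G₂ p) =
      dft G₁ (fun x₁ => dft G₂ (fun x₂ => f (x₁, x₂)) p.2) p.1 := by
  simp only [dft, Fintype.sum_prod_type, Finset.sum_mul, addCharProdEquiv_apply, Prod.fst_neg,
    Prod.snd_neg]
  refine Finset.sum_congr rfl fun _ _ => Finset.sum_congr rfl fun _ _ => ?_
  ring

theorem ncard_support_dft_prod (f : G₁ × G₂ → ℂ) :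
    (support (dft (G₁ × G₂) f)).ncard =
      {p : AddChar G₂ ℂ × AddChar G₁ ℂ |
        dft G₁ (fun x₁ => dft G₂ (fun x₂ => f (x₁, x₂)) p.1) p.2 ≠ 0}.ncard := by
  let e := (Equiv.prodComm (AddChar G₂ ℂ) (AddChar G₁ ℂ)).trans (addCharProdEquiv G₁ G₂)
  rw [← Set.ncard_image_of_injective _ e.injective]
  congr 1
  ext χ
  obtain ⟨p, rfl⟩ := e.surjective χ
  rw [e.injective.mem_set_image]
  simp [e, dft_addCharProdEquiv]

theorem ncard_support_dft_tensor (f₁ : G₁ → ℂ) (f₂ : G₂ → ℂ) :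
    (support (dft (G₁ × G₂) fun x => f₁ x.1 * f₂ x.2)).ncard =
      (support (dft G₁ f₁)).ncard * (support (dft G₂ f₂)).ncard := by
  rw [ncard_support_dft_prod, mul_comm, ← Set.ncard_prod]
  congr 1
  ext p
  have h : dft G₁ (fun x₁ => dft G₂ (fun x₂ => f₁ x₁ * f₂ x₂) p.1) p.2 =
      dft G₂ f₂ p.1 * dft G₁ f₁ p.2 := by
    simp only [dft, mul_assoc, ← Finset.mul_sum]
    rw [Finset.mul_sum]
    exact Finset.sum_congr rfl fun _ _ => by ring
  simp [h]

theorem ncard_support_dft_swap (f : G₁ × G₂ → ℂ) :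
    (support (dft (G₂ × G₁) fun x => f x.swap)).ncard = (support (dft (G₁ × G₂) f)).ncard := by
  rw [ncard_support_dft_prod, ← Set.ncard_image_of_injective _ (addCharProdEquiv G₁ G₂).injective]
  congr 1
  ext χ
  obtain ⟨p, rfl⟩ := (addCharProdEquiv G₁ G₂).surjective χ
  rw [(addCharProdEquiv G₁ G₂).injective.mem_set_image, mem_support, dft_addCharProdEquiv,
    Set.mem_ofPred_eq, not_iff_not]
  simp only [dft, Prod.swap_prod_mk, Finset.sum_mul]
  rw [Finset.sum_comm]
  simp only [mul_right_comm]

end Dual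

section Theta

variable {G : Type*} [AddCommGroup G] [Fintype G]

theorem dft_smul_sub (f g : G → ℂ) (c d : ℂ) (χ : AddChar G ℂ) :
    dft G (fun x => c * f x - d * g x) χ = c * dft G f χ - d * dft G g χ := by
  simp only [dft, Finset.mul_sum, ← Finset.sum_sub_distrib]
  exact Finset.sum_congr rfl fun _ _ => by ring

theorem dft_zero (χ : AddChar G ℂ) : dft G (fun _ => 0) χ = 0 := by
  simp [dft]

theorem dft_ne_zero {f : G → ℂ} (hf : f ≠ 0) : dft G f ≠ 0 := by
  classical
  contrapose! hf
  ext y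
  have h : ∑ χ : AddChar G ℂ, dft G f χ * χ y = f y * Fintype.card G := by
    simp only [dft, Finset.sum_mul, mul_assoc, ← AddChar.map_add_eq_mul]
    rw [Finset.sum_comm]
    simp only [← Finset.mul_sum, AddChar.sum_apply_eq_ite]
    simp [neg_add_eq_zero]
  rw [hf] at h
  simpa using h.symm

theorem theta_le {k : ℕ} {f : G → ℂ} (hf : f ≠ 0) (hk : (support f).ncard ≤ k) :
    theta G k ≤ (support (dft G f)).ncard :=
  Nat.sInf_le ⟨f, hf, hk, rfl⟩

theorem exists_theta (G : Type*) [AddCommGroup G] [Fintype G] {k : ℕ} (hk : 1 ≤ k) :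
    ∃ f : G → ℂ, f ≠ 0 ∧ (support f).ncard ≤ k ∧ (support (dft G f)).ncard = theta G k := by
  classical
  refine Nat.sInf_mem (s := {l | ∃ f : G → ℂ, f ≠ 0 ∧ (support f).ncard ≤ k ∧
    (support (dft G f)).ncard = l}) ⟨_, Pi.single 0 1, by simp, ?_, rfl⟩
  rw [Pi.support_single_of_ne one_ne_zero]
  simpa using hk

theorem theta_pos (G : Type*) [AddCommGroup G] [Fintype G] {k : ℕ} (hk : 1 ≤ k) :
    0 < theta G k := by
  obtain ⟨f, hf, -, h⟩ := exists_theta G hk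
  rw [← h]
  exact one_le_ncard_support (dft_ne_zero hf)

theorem theta_anti (G : Type*) [AddCommGroup G] [Fintype G] {k l : ℕ} (hk : 1 ≤ k)
    (hkl : k ≤ l) : theta G l ≤ theta G k := by
  obtain ⟨f, hf, hs, h⟩ := exists_theta G hk
  exact h ▸ theta_le hf (hs.trans hkl)

theorem theta_prod_le (G₁ G₂ : Type*) [AddCommGroup G₁] [Fintype G₁] [AddCommGroup G₂]
    [Fintype G₂] {k l₁ l₂ : ℕ} (h₁ : 1 ≤ l₁) (h₂ : 1 ≤ l₂) (h : l₁ * l₂ ≤ k) :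
    theta (G₁ × G₂) k ≤ theta G₁ l₁ * theta G₂ l₂ := by
  obtain ⟨f₁, hf₁, hs₁, ht₁⟩ := exists_theta G₁ h₁
  obtain ⟨f₂, hf₂, hs₂, ht₂⟩ := exists_theta G₂ h₂
  rw [← ht₁, ← ht₂, ← ncard_support_dft_tensor]
  refine theta_le (tensor_ne_zero hf₁ hf₂) ?_
  rw [ncard_support_tensor]
  exact (Nat.mul_le_mul hs₁ hs₂).trans h

end Theta

section Product

variable {G₁ G₂ : Type*} [AddCommGroup G₂] [Fintype G₂]

/-- The characters of `G₂` that occur in the spectrum of some row of `f`. -/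
def rowSpectrum (f : G₁ × G₂ → ℂ) : Set (AddChar G₂ ℂ) :=
  {χ | (fun x₁ => dft G₂ (fun x₂ => f (x₁, x₂)) χ) ≠ 0}

theorem support_dft_row_subset (f : G₁ × G₂ → ℂ) (x₁ : G₁) :
    support (dft G₂ fun x₂ => f (x₁, x₂)) ⊆ rowSpectrum f :=
  fun _ hχ => Function.ne_iff.2 ⟨x₁, hχ⟩

variable [Fintype G₁]

/-- The size `s` of the row support and the minimal size `t` of the support of a nonzero row
witness the lower bound for the spectrum of a function on a product. -/
theorem exists_min_row {f : G₁ × G₂ → ℂ} (hf : f ≠ 0) :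
    ∃ t, 1 ≤ t ∧ t ≤ Fintype.card G₂ ∧ (rowSupport f).ncard * t ≤ (support f).ncard ∧
      theta G₂ t ≤ (rowSpectrum f).ncard := by
  obtain ⟨a, ha, hmin⟩ := Set.exists_min_image (rowSupport f)
    (fun x₁ => (support fun x₂ => f (x₁, x₂)).ncard) (Set.toFinite _) (rowSupport_nonempty hf)
  exact ⟨(support fun x₂ => f (a, x₂)).ncard, one_le_ncard_support ha, ncard_support_le_card _,
    ncard_mul_le_ncard_of_fibers (support f) _ _ hmin,
    (theta_le ha le_rfl).trans
      (Set.ncard_le_ncard (support_dft_row_subset f a) (Set.toFinite _))⟩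

variable [AddCommGroup G₁]

theorem theta_le_ncard_support_dft_slice (f : G₁ × G₂ → ℂ) {χ : AddChar G₂ ℂ}
    (hχ : χ ∈ rowSpectrum f) :
    theta G₁ (rowSupport f).ncard ≤
      (support (dft G₁ fun x₁ => dft G₂ (fun x₂ => f (x₁, x₂)) χ)).ncard := by
  refine theta_le hχ (Set.ncard_le_ncard (fun x₁ hx₁ => ?_) (Set.toFinite _))
  by_contra h
  have h0 : (fun x₂ => f (x₁, x₂)) = fun _ => 0 := not_not.1 h
  rw [mem_support, h0, dft_zero] at hx₁
  exact hx₁ rfl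

theorem rowSpectrum_mul_theta_le (f : G₁ × G₂ → ℂ) :
    (rowSpectrum f).ncard * theta G₁ (rowSupport f).ncard ≤
      (support (dft (G₁ × G₂) f)).ncard := by
  rw [ncard_support_dft_prod]
  exact ncard_mul_le_ncard_of_fibers _ _ _ fun χ hχ => theta_le_ncard_support_dft_slice f hχ

/-- A function on a product with spectrum of minimal size determines a factorization of `θ`. -/
theorem exists_theta_factorization {k : ℕ} {f : G₁ × G₂ → ℂ} (hf : f ≠ 0)
    (hk : (support f).ncard ≤ k)
    (hθ : (support (dft (G₁ × G₂) f)).ncard ≤ theta (G₁ × G₂) k) :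
    1 ≤ (rowSupport f).ncard ∧ (rowSupport f).ncard ≤ Fintype.card G₁ ∧
    ∃ t, 1 ≤ t ∧ t ≤ Fintype.card G₂ ∧ (rowSupport f).ncard * t ≤ k ∧
      theta (G₁ × G₂) k = theta G₁ (rowSupport f).ncard * theta G₂ t ∧
      (rowSpectrum f).ncard = theta G₂ t := by
  have hs : 1 ≤ (rowSupport f).ncard :=
    (Set.ncard_pos (Set.toFinite _)).2 (rowSupport_nonempty hf)
  obtain ⟨t, ht, ht', hst, hX⟩ := exists_min_row hf
  have hle := theta_prod_le G₁ G₂ hs ht (hst.trans hk)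
  have hup := (rowSpectrum_mul_theta_le f).trans hθ
  rw [mul_comm] at hup
  have hX' : (rowSpectrum f).ncard ≤ theta G₂ t :=
    Nat.le_of_mul_le_mul_left (hup.trans hle) (theta_pos G₁ hs)
  have hXt := le_antisymm hX' hX
  refine ⟨hs, ?_, t, ht, ht', hst.trans hk, le_antisymm hle (hXt ▸ hup), hXt⟩
  rw [← Nat.card_eq_fintype_card]
  exact Set.ncard_le_card _

end Product

/-- A tensor product is an equality case as soon as its factors are and `θ` is multiplicative. -/
theorem IsEqualityCase.tensor {G₁ G₂ : Type*} [AddCommGroup G₁] [Fintype G₁] [AddCommGroup G₂]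
    [Fintype G₂] {k₁ k₂ : ℕ} (heq : theta (G₁ × G₂) (k₁ * k₂) = theta G₁ k₁ * theta G₂ k₂)
    {f₁ : G₁ → ℂ} {f₂ : G₂ → ℂ} (h₁ : IsEqualityCase G₁ k₁ f₁) (h₂ : IsEqualityCase G₂ k₂ f₂) :
    IsEqualityCase (G₁ × G₂) (k₁ * k₂) fun x => f₁ x.1 * f₂ x.2 :=
  ⟨tensor_ne_zero h₁.1 h₂.1, by rw [ncard_support_tensor, h₁.2.1, h₂.2.1],
    by rw [ncard_support_dft_tensor, h₁.2.2, h₂.2.2, heq]⟩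

/-- Two functions with support in `T` and spectrum in `X` are proportional if `T` is minimal for
nonzero functions with spectrum in `X`. -/
theorem mul_eq_mul_of_support_subset {G : Type*} [AddCommGroup G] [Fintype G] {T : Set G}
    {X : Set (AddChar G ℂ)}
    (hT : ∀ g : G → ℂ, g ≠ 0 → support (dft G g) ⊆ X → T.ncard ≤ (support g).ncard)
    {a b : G → ℂ} (ha : support a ⊆ T) (hb : support b ⊆ T) (hXa : support (dft G a) ⊆ X)
    (hXb : support (dft G b) ⊆ X) {y : G} (hy : y ∈ T) (x : G) :
    b y * a x = a y * b x := by
  by_contra hne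
  have hg : (fun x => b y * a x - a y * b x) ≠ 0 :=
    Function.ne_iff.2 ⟨x, sub_ne_zero.2 hne⟩
  refine (hT _ hg ?_).not_gt (Set.ncard_lt_ncard ⟨?_, fun h => h hy ?_⟩ (Set.toFinite _))
  · intro χ hχ
    by_contra hχX
    refine hχ ?_
    rw [dft_smul_sub, notMem_support.1 fun h => hχX (hXa h),
      notMem_support.1 fun h => hχX (hXb h)]
    ring
  · intro z hz
    by_contra hzT
    refine hz ?_
    simp [notMem_support.1 fun h => hzT (ha h), notMem_support.1 fun h => hzT (hb h)]
  · ring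

/-- Every equality case on a product is a tensor product of equality cases, if `(k₁, k₂)` is the
only pair realizing `θ(k, G₁ × G₂)`. -/
theorem IsEqualityCase.exists_tensor {G₁ G₂ : Type*} [AddCommGroup G₁] [Fintype G₁]
    [AddCommGroup G₂] [Fintype G₂] {k k₁ k₂ : ℕ}
    (h₁ : 1 ≤ k₁) (h₁' : k₁ ≤ Fintype.card G₁) (h₂' : k₂ ≤ Fintype.card G₂)
    (hle : k₁ * k₂ ≤ k)
    (heq : theta (G₁ × G₂) k = theta G₁ k₁ * theta G₂ k₂)
    (huniq : ∀ l₁ l₂ : ℕ, 1 ≤ l₁ → l₁ ≤ Fintype.card G₁ → 1 ≤ l₂ → l₂ ≤ Fintype.card G₂ →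
      l₁ * l₂ ≤ k → theta (G₁ × G₂) k = theta G₁ l₁ * theta G₂ l₂ → l₁ = k₁ ∧ l₂ = k₂)
    {f : G₁ × G₂ → ℂ} (hf : IsEqualityCase (G₁ × G₂) k f) :
    k = k₁ * k₂ ∧ ∃ (f₁ : G₁ → ℂ) (f₂ : G₂ → ℂ), IsEqualityCase G₁ k₁ f₁ ∧
      IsEqualityCase G₂ k₂ f₂ ∧ f = fun x => f₁ x.1 * f₂ x.2 := by
  obtain ⟨hf0, hfk, hfθ⟩ := hf
  obtain ⟨hs, hs', t, ht, ht', hst, hθ, hX⟩ := exists_theta_factorization hf0 hfk.le hfθ.le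
  obtain ⟨hsk, rfl⟩ := huniq _ _ hs hs' ht ht' hst hθ
  set f' : G₂ × G₁ → ℂ := fun x => f x.swap with hf'
  have hf'0 : f' ≠ 0 := by
    obtain ⟨a, ha⟩ := Function.ne_iff.1 hf0
    exact Function.ne_iff.2 ⟨a.swap, by simpa [hf'] using ha⟩
  have hcols : (rowSupport f').ncard = t := by
    have hs2 : 1 ≤ (rowSupport f').ncard :=
      (Set.ncard_pos (Set.toFinite _)).2 (rowSupport_nonempty hf'0)
    have hs2' : (rowSupport f').ncard ≤ Fintype.card G₂ := by
      rw [← Nat.card_eq_fintype_card]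
      exact Set.ncard_le_card _
    obtain ⟨u, hu, hu', hsu, hXu⟩ := exists_min_row hf'0
    rw [ncard_support_swap, hfk, mul_comm] at hsu
    have hup := rowSpectrum_mul_theta_le f'
    rw [ncard_support_dft_swap, hfθ] at hup
    exact (huniq _ _ hu hu' hs2 hs2' hsu (le_antisymm (theta_prod_le G₁ G₂ hu hs2 hsu)
      ((Nat.mul_le_mul_right _ hXu).trans hup))).2
  have hsub := support_subset_prod f
  have hcard : (rowSupport f ×ˢ rowSupport f').ncard = k₁ * t := by
    rw [Set.ncard_prod, hsk, hcols]
  have hk : k = k₁ * t := by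
    refine le_antisymm ?_ hle
    rw [← hfk, ← hcard]
    exact Set.ncard_le_ncard hsub (Set.toFinite _)
  have hsupp : support f = rowSupport f ×ˢ rowSupport f' :=
    Set.eq_of_subset_of_ncard_le hsub (by rw [hcard, hfk, hk]) (Set.toFinite _)
  have hmin : ∀ g : G₂ → ℂ, g ≠ 0 → support (dft G₂ g) ⊆ rowSpectrum f →
      (rowSupport f').ncard ≤ (support g).ncard := by
    intro g hg hgX
    rw [hcols]
    by_contra! hlt
    have hg1 := one_le_ncard_support hg
    have hθg : theta G₂ (support g).ncard = theta G₂ t :=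
      le_antisymm ((theta_le hg le_rfl).trans
        (hX ▸ Set.ncard_le_ncard hgX (Set.toFinite _))) (theta_anti G₂ hg1 hlt.le)
    exact hlt.ne (huniq _ _ h₁ h₁' hg1 (ncard_support_le_card g)
      ((Nat.mul_le_mul_left _ hlt.le).trans hle) (hθg ▸ heq)).2
  have hrow : ∀ x₁, support (fun x₂ => f (x₁, x₂)) ⊆ rowSupport f' :=
    fun x₁ x₂ hx => (hsub (a := (x₁, x₂)) hx).2
  obtain ⟨a, ha⟩ := rowSupport_nonempty hf0
  obtain ⟨y, hy⟩ := rowSupport_nonempty hf'0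
  have hay : f (a, y) ≠ 0 := by
    have : (a, y) ∈ support f := hsupp ▸ ⟨ha, hy⟩
    exact this
  have hfac : f = fun x => (f (x.1, y) / f (a, y)) * f (a, x.2) := by
    ext ⟨x₁, x₂⟩
    have := mul_eq_mul_of_support_subset hmin (hrow x₁) (hrow a)
      (support_dft_row_subset f x₁) (support_dft_row_subset f a) hy x₂
    field_simp
    linear_combination this
  have hS₁ : (support fun x₁ => f (x₁, y) / f (a, y)).ncard = k₁ := by
    rw [← hsk]
    congr 1
    ext x₁
    have h : (x₁, y) ∈ support f ↔ x₁ ∈ rowSupport f := by simp [hsupp, hy]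
    rw [← h]
    simp [hay]
  have hS₂ : (support fun x₂ => f (a, x₂)).ncard = t := by
    rw [← hcols]
    congr 1
    ext x₂
    have h : (a, x₂) ∈ support f ↔ x₂ ∈ rowSupport f' := by simp [hsupp, ha]
    rw [← h]
    rfl
  have hf₁0 : (fun x₁ => f (x₁, y) / f (a, y)) ≠ 0 :=
    Function.ne_iff.2 ⟨a, by simp [hay]⟩
  have hθ₂ : (support (dft G₂ fun x₂ => f (a, x₂))).ncard = theta G₂ t :=
    le_antisymm (hX ▸ Set.ncard_le_ncard (support_dft_row_subset f a) (Set.toFinite _))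
      (theta_le ha hS₂.le)
  refine ⟨hk, _, _, ⟨hf₁0, hS₁, ?_⟩, ⟨ha, hS₂, hθ₂⟩, hfac⟩
  refine Nat.eq_of_mul_eq_mul_right (theta_pos G₂ ht) ?_
  rw [← heq, ← hfθ, ← hθ₂, ← ncard_support_dft_tensor, ← hfac]

/-- If `(k₁, k₂)` is the unique pair with `k₁ k₂ ≤ k`, `1 ≤ kᵢ ≤ |Gᵢ|` and
`θ(k, G₁ × G₂) = θ(k₁, G₁) θ(k₂, G₂)`, then there are equality cases for `(k, G₁ × G₂)` iff
`k = k₁ k₂` and there are equality cases for `(k₁, G₁)` and `(k₂, G₂)`; moreover every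
equality case for `(k, G₁ × G₂)` is a tensor product of equality cases. -/
theorem equality_case_prod (G₁ G₂ : Type*) [AddCommGroup G₁] [Fintype G₁]
    [AddCommGroup G₂] [Fintype G₂] (k k₁ k₂ : ℕ)
    (hk1 : 1 ≤ k) (hk2 : k ≤ Fintype.card (G₁ × G₂))
    (h₁ : 1 ≤ k₁) (h₁' : k₁ ≤ Fintype.card G₁)
    (h₂ : 1 ≤ k₂) (h₂' : k₂ ≤ Fintype.card G₂)
    (hle : k₁ * k₂ ≤ k)
    (heq : theta (G₁ × G₂) k = theta G₁ k₁ * theta G₂ k₂)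
    (huniq : ∀ l₁ l₂ : ℕ, 1 ≤ l₁ → l₁ ≤ Fintype.card G₁ → 1 ≤ l₂ → l₂ ≤ Fintype.card G₂ →
      l₁ * l₂ ≤ k → theta (G₁ × G₂) k = theta G₁ l₁ * theta G₂ l₂ → l₁ = k₁ ∧ l₂ = k₂) :
    ((∃ f : G₁ × G₂ → ℂ, IsEqualityCase (G₁ × G₂) k f) ↔
      (k = k₁ * k₂ ∧ (∃ f₁ : G₁ → ℂ, IsEqualityCase G₁ k₁ f₁) ∧
        (∃ f₂ : G₂ → ℂ, IsEqualityCase G₂ k₂ f₂))) ∧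
    (∀ f : G₁ × G₂ → ℂ, IsEqualityCase (G₁ × G₂) k f →
      ∃ (f₁ : G₁ → ℂ) (f₂ : G₂ → ℂ), IsEqualityCase G₁ k₁ f₁ ∧ IsEqualityCase G₂ k₂ f₂ ∧
        f = fun x => f₁ x.1 * f₂ x.2) := by
  refine ⟨⟨?_, ?_⟩, fun f hf =>
    (hf.exists_tensor h₁ h₁' h₂' hle heq huniq).2⟩
  · rintro ⟨f, hf⟩
    obtain ⟨hk, f₁, f₂, hf₁, hf₂, -⟩ := hf.exists_tensor h₁ h₁' h₂' hle heq huniq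
    exact ⟨hk, ⟨f₁, hf₁⟩, ⟨f₂, hf₂⟩⟩
  · rintro ⟨rfl, ⟨f₁, hf₁⟩, ⟨f₂, hf₂⟩⟩
    exact ⟨_, hf₁.tensor heq hf₂⟩
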